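/- Let G₁ be a complete multipartite graph on vertex set {1,…,n} (i.e. there is a partition of {1,…,n} such that {i,j} is an edge of G₁ exactly when i and j lie in different blocks), and let G₂ be its complement (a disjoint union of complete graphs). Then the multiplication map E_{G₁} ⊗_ℚ E_{G₂} → E_n, determined by P ⊗ Q ↦ PQ, is a ℚ-linear bijection. -/

import Mathlib

open scoped TensorProduct

namespace FK

/-- Defining relations of the Fomin–Kirillov algebra `E n`, with generators indexed by
ordered pairs `(i, j)`; we also impose `x_{ii} = 0` and the antisymmetry `x_{ji} = -x_{ij}`,
so that the generators of the algebra are the `x_{ij}` for `i < j`. -/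
inductive Rel (n : ℕ) : FreeAlgebra ℚ (Fin n × Fin n) → FreeAlgebra ℚ (Fin n × Fin n) → Prop
  | diag (i : Fin n) : Rel n (FreeAlgebra.ι ℚ (i, i)) 0
  | antisymm (i j : Fin n) (hij : i ≠ j) :
      Rel n (FreeAlgebra.ι ℚ (j, i)) (-FreeAlgebra.ι ℚ (i, j))
  | square (i j : Fin n) (hij : i ≠ j) :
      Rel n (FreeAlgebra.ι ℚ (i, j) * FreeAlgebra.ι ℚ (i, j)) 0
  | comm (i j k l : Fin n) (h : List.Nodup [i, j, k, l]) :
      Rel n (FreeAlgebra.ι ℚ (i, j) * FreeAlgebra.ι ℚ (k, l))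
        (FreeAlgebra.ι ℚ (k, l) * FreeAlgebra.ι ℚ (i, j))
  | cyclic (i j k : Fin n) (h : List.Nodup [i, j, k]) :
      Rel n (FreeAlgebra.ι ℚ (i, j) * FreeAlgebra.ι ℚ (j, k)
        + FreeAlgebra.ι ℚ (j, k) * FreeAlgebra.ι ℚ (k, i)
        + FreeAlgebra.ι ℚ (k, i) * FreeAlgebra.ι ℚ (i, j)) 0

/-- The Fomin–Kirillov algebra `E n`. -/
abbrev E (n : ℕ) : Type := RingQuot (Rel n)

/-- The generator `x_{ij}` of `E n`. -/
noncomputable def x (n : ℕ) (i j : Fin n) : E n :=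
  RingQuot.mkAlgHom ℚ (Rel n) (FreeAlgebra.ι ℚ (i, j))

/-- The product of generators `x_{i₁j₁} ⋯ x_{i_d j_d}` given by a list of pairs. -/
noncomputable def word (n : ℕ) (l : List (Fin n × Fin n)) : E n :=
  (l.map fun p => x n p.1 p.2).prod

/-- The degree-`d` component of `E n`: the span of products of `d` generators. -/
def degSpan (n : ℕ) (d : ℕ) : Submodule ℚ (E n) :=
  Submodule.span ℚ {y | ∃ l : List (Fin n × Fin n),
    (∀ p ∈ l, p.1 ≠ p.2) ∧ l.length = d ∧ y = word n l}

/-- The Fomin–Kirillov algebra of a graph `G`: the subalgebra of `E n` generated by the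
`x_{ij}` with `{i,j}` an edge of `G`. -/
def EG (n : ℕ) (G : SimpleGraph (Fin n)) : Subalgebra ℚ (E n) :=
  Algebra.adjoin ℚ {y | ∃ i j : Fin n, G.Adj i j ∧ y = x n i j}

/-- The degree-`d` component `E_G^d = E_G ∩ E_n^d`. -/
def EGdeg (n : ℕ) (G : SimpleGraph (Fin n)) (d : ℕ) : Submodule ℚ (E n) :=
  (EG n G).toSubmodule ⊓ degSpan n d

/-- The positive-degree part `E_G⁺` of `E_G`. -/
def EGplus (n : ℕ) (G : SimpleGraph (Fin n)) : Submodule ℚ (E n) :=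
  ⨆ d : ℕ, ⨆ _ : 1 ≤ d, EGdeg n G d


/-- The `ℚ`-linear multiplication map `A ⊗[ℚ] B → E n`, `P ⊗ Q ↦ PQ`, for subalgebras
`A`, `B` of `E n`. -/
noncomputable def mulMap (n : ℕ) (A B : Subalgebra ℚ (E n)) :
    (↥A ⊗[ℚ] ↥B) →ₗ[ℚ] E n :=
  TensorProduct.lift
    { toFun := fun p =>
        { toFun := fun q => (p : E n) * (q : E n)
          map_add' := by intro q q'; simp [mul_add]
          map_smul' := by intro c q; simp [mul_smul_comm] }
      map_add' := by intro p p'; ext q; simp [add_mul]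
      map_smul' := by intro c p; ext q; simp [smul_mul_assoc] }

section

/-- Ring structure on `E n` extending the given semiring structure. -/
@[reducible] noncomputable def ringE (n : ℕ) : Ring (E n) := Algebra.semiringToRing ℚ

attribute [local instance] ringE

/-- Negation on `E n`, from `ringE`. -/
@[reducible] noncomputable def negE (n : ℕ) : Neg (E n) := (ringE n).toNeg

/-- Subtraction on `E n`, from `ringE`. -/
@[reducible] noncomputable def subE (n : ℕ) : Sub (E n) := (ringE n).toSub

attribute [local instance] negE subE

/-- Additive group structure on `E n ⊗ E n` extending the given monoid structure. -/
@[reducible] noncomputable def grpT (n : ℕ) : AddCommGroup (E n ⊗[ℚ] E n) :=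
  Module.addCommMonoidToAddCommGroup ℚ

attribute [local instance] grpT

/-- Negation on `E n ⊗ E n`. -/
@[reducible] noncomputable def negT (n : ℕ) : Neg (E n ⊗[ℚ] E n) := (grpT n).toNeg

/-- Subtraction on `E n ⊗ E n`. -/
@[reducible] noncomputable def subT (n : ℕ) : Sub (E n ⊗[ℚ] E n) := (grpT n).toSub

attribute [local instance] negT subT

theorem neg_tmulE {n : ℕ} (a b : E n) : (-a) ⊗ₜ[ℚ] b = -(a ⊗ₜ[ℚ] b) := by
  rw [eq_neg_iff_add_eq_zero, ← TensorProduct.add_tmul, neg_add_cancel, TensorProduct.zero_tmul]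

theorem tmul_negE {n : ℕ} (a b : E n) : a ⊗ₜ[ℚ] (-b) = -(a ⊗ₜ[ℚ] b) := by
  rw [eq_neg_iff_add_eq_zero, ← TensorProduct.tmul_add, neg_add_cancel, TensorProduct.tmul_zero]

theorem x_diag (n : ℕ) (i : Fin n) : x n i i = 0 := by
  have := RingQuot.mkAlgHom_rel ℚ (Rel.diag (n := n) i)
  simpa [x] using this

theorem x_anti (n : ℕ) (i j : Fin n) : x n j i = - x n i j := by
  by_cases hij : i = j
  · subst hij; simp [x_diag]
  · have := RingQuot.mkAlgHom_rel ℚ (Rel.antisymm (n := n) i j hij)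
    simpa [x] using this

theorem x_sq (n : ℕ) (i j : Fin n) : x n i j * x n i j = 0 := by
  by_cases hij : i = j
  · subst hij; simp [x_diag]
  · have := RingQuot.mkAlgHom_rel ℚ (Rel.square (n := n) i j hij)
    simpa [x] using this

theorem x_comm (n : ℕ) (i j k l : Fin n) (h : List.Nodup [i, j, k, l]) :
    x n i j * x n k l = x n k l * x n i j := by
  have := RingQuot.mkAlgHom_rel ℚ (Rel.comm (n := n) i j k l h)
  simpa [x] using this

theorem x_cyc (n : ℕ) (i j k : Fin n) (h : List.Nodup [i, j, k]) :
    x n i j * x n j k + x n j k * x n k i + x n k i * x n i j = 0 := by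
  have := RingQuot.mkAlgHom_rel ℚ (Rel.cyclic (n := n) i j k h)
  simpa [x] using this

/-- Universal property of `E n`. -/
theorem exists_lift {n : ℕ} {A : Type*} [Ring A] [Algebra ℚ A] (g : Fin n → Fin n → A)
    (h0 : ∀ i, g i i = 0) (h1 : ∀ i j, i ≠ j → g j i = - g i j)
    (h2 : ∀ i j, i ≠ j → g i j * g i j = 0)
    (h3 : ∀ i j k l, List.Nodup [i, j, k, l] → g i j * g k l = g k l * g i j)
    (h4 : ∀ i j k, List.Nodup [i, j, k] → g i j * g j k + g j k * g k i + g k i * g i j = 0) :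
    ∃ φ : E n →ₐ[ℚ] A, ∀ i j, φ (x n i j) = g i j := by
  refine ⟨RingQuot.liftAlgHom ℚ ⟨FreeAlgebra.lift ℚ (fun p => g p.1 p.2), ?_⟩, ?_⟩
  · intro a b hab
    cases hab with
    | diag i => simpa using h0 i
    | antisymm i j h => simpa using h1 i j h
    | square i j h => simpa using h2 i j h
    | comm i j k l h => simpa using h3 i j k l h
    | cyclic i j k h => simpa using h4 i j k h
  · intro i j
    simp [x]

theorem exists_act {n : ℕ} (σ : Equiv.Perm (Fin n)) :
    ∃ φ : E n →ₐ[ℚ] E n, ∀ i j, φ (x n i j) = x n (σ i) (σ j) := by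
  refine exists_lift _ (fun i => x_diag _ _) (fun i j _ => x_anti _ _ _)
    (fun i j _ => x_sq _ _ _) (fun i j k l h => x_comm _ _ _ _ _ ?_)
    (fun i j k h => x_cyc _ _ _ _ ?_)
  · simpa using h
  · simpa using h

/-- The permutation action on `E n`. -/
noncomputable def act {n : ℕ} (σ : Equiv.Perm (Fin n)) : E n →ₐ[ℚ] E n :=
  (exists_act σ).choose

theorem act_x {n : ℕ} (σ : Equiv.Perm (Fin n)) (i j : Fin n) :
    act σ (x n i j) = x n (σ i) (σ j) := (exists_act σ).choose_spec i j

theorem act_act {n : ℕ} (σ τ : Equiv.Perm (Fin n)) (a : E n) :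
    act σ (act τ a) = act (σ * τ) a := by
  have : (act σ).comp (act τ) = act (σ * τ) := by
    apply RingQuot.ringQuot_ext'
    ext p
    have h := act_x σ (τ p.1) (τ p.2)
    have h' := act_x τ p.1 p.2
    have h'' := act_x (σ * τ) p.1 p.2
    simp only [x] at h h' h''
    simp [h, h', h'']
  rw [← this]; rfl

/-- The braided-coproduct operator attached to `x_{ij}`. -/
noncomputable def op {n : ℕ} (f : Fin n → Fin n) (i j : Fin n) :
    Module.End ℚ (E n ⊗[ℚ] E n) :=
  TensorProduct.map (LinearMap.mulLeft ℚ (x n i j)) LinearMap.id +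
    if f i = f j then
      TensorProduct.map (act (Equiv.swap i j)).toLinearMap (LinearMap.mulLeft ℚ (x n i j))
    else 0

theorem op_same {n : ℕ} (f : Fin n → Fin n) (i j : Fin n) (h : f i = f j) (a b : E n) :
    op f i j (a ⊗ₜ b) = (x n i j * a) ⊗ₜ b +
      act (Equiv.swap i j) a ⊗ₜ (x n i j * b) := by
  simp [op, h]

theorem op_diff {n : ℕ} (f : Fin n → Fin n) (i j : Fin n) (h : f i ≠ f j) (a b : E n) :
    op f i j (a ⊗ₜ b) = (x n i j * a) ⊗ₜ b := by
  simp [op, h]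

theorem op_cyc_mixed {n : ℕ} (f : Fin n → Fin n) (i j k : Fin n) (h : List.Nodup [i, j, k])
    (hij : f i = f j) (hjk : f j ≠ f k) (a b : E n) :
    op f i j (op f j k (a ⊗ₜ b)) + op f j k (op f k i (a ⊗ₜ b))
      + op f k i (op f i j (a ⊗ₜ b)) = 0 := by
  have hki : f k ≠ f i := by rw [hij]; exact hjk.symm
  have hc : ((x n i j * x n j k + x n j k * x n k i + x n k i * x n i j) * a) ⊗ₜ[ℚ] b = 0 := by
    rw [x_cyc n i j k h]; simp
  simp only [List.nodup_cons, List.mem_cons, List.not_mem_nil, not_or, or_false] at h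
  obtain ⟨⟨h1, h2⟩, h3, -⟩ := h
  have e : act (Equiv.swap i j) (x n j k) = - x n k i := by
    rw [act_x, Equiv.swap_apply_right, Equiv.swap_apply_of_ne_of_ne (Ne.symm h2) (Ne.symm h3),
      x_anti]
  simp only [op_same f i j hij, op_diff f j k hjk, op_diff f k i hki, map_add, map_mul, e]
  simp only [add_mul, TensorProduct.add_tmul, mul_assoc, neg_mul, neg_tmulE] at hc ⊢
  linear_combination (norm := module) hc

theorem exists_phi {n : ℕ} (f : Fin n → Fin n) :
    ∃ φ : E n →ₐ[ℚ] Module.End ℚ (E n ⊗[ℚ] E n), ∀ i j, φ (x n i j) = op f i j := by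
  apply exists_lift (A := Module.End ℚ (E n ⊗[ℚ] E n)) (op f)
  · intro i
    apply TensorProduct.ext'
    intro a b
    simp [op_same, x_diag]
  · intro i j _
    apply TensorProduct.ext'
    intro a b
    by_cases h : f i = f j
    · simp only [op_same f i j h, op_same f j i h.symm, LinearMap.neg_apply, x_anti n i j,
        Equiv.swap_comm j i, neg_mul, neg_tmulE, tmul_negE]
      abel
    · simp only [op_diff f i j h, op_diff f j i (Ne.symm h), LinearMap.neg_apply, x_anti n i j,
        neg_mul, neg_tmulE]
  · intro i j _
    apply TensorProduct.ext'
    intro a b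
    rw [Module.End.mul_apply]
    by_cases h : f i = f j
    · simp only [op_same f i j h, map_add, map_mul, act_x, Equiv.swap_apply_left,
        Equiv.swap_apply_right, ← mul_assoc, x_sq, x_anti n i j]
      simp only [neg_mul, neg_tmulE, zero_mul, TensorProduct.zero_tmul, TensorProduct.tmul_zero,
        LinearMap.zero_apply]
      module
    · simp only [op_diff f i j h, ← mul_assoc, x_sq]
      simp
  · intro i j k l hn
    have hx := x_comm n i j k l hn
    simp only [List.nodup_cons, List.mem_cons, List.not_mem_nil, not_or, or_false] at hn
    obtain ⟨⟨h1, h2, h3⟩, ⟨h4, h5⟩, h6, -⟩ := hn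
    have e1 : act (Equiv.swap i j) (x n k l) = x n k l := by
      rw [act_x, Equiv.swap_apply_of_ne_of_ne (Ne.symm h2) (Ne.symm h4),
        Equiv.swap_apply_of_ne_of_ne (Ne.symm h3) (Ne.symm h5)]
    have e2 : act (Equiv.swap k l) (x n i j) = x n i j := by
      rw [act_x, Equiv.swap_apply_of_ne_of_ne h2 h3, Equiv.swap_apply_of_ne_of_ne h4 h5]
    have e3 : Equiv.swap i j * Equiv.swap k l = Equiv.swap k l * Equiv.swap i j := by
      ext t; simp only [Equiv.Perm.mul_apply, Equiv.swap_apply_def]; grind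
    apply TensorProduct.ext'
    intro a b
    rw [Module.End.mul_apply, Module.End.mul_apply]
    by_cases h : f i = f j <;> by_cases h' : f k = f l
    · simp only [op_same f i j h, op_same f k l h', map_add, map_mul, e1, e2, act_act, e3,
        ← mul_assoc, hx]
      abel
    · simp only [op_same f i j h, op_diff f k l h', map_add, map_mul, e1, e2, act_act, e3,
        ← mul_assoc, hx]
    · simp only [op_diff f i j h, op_same f k l h', map_add, map_mul, e1, e2, act_act, e3,
        ← mul_assoc, hx]
    · simp only [op_diff f i j h, op_diff f k l h', ← mul_assoc, hx]
  · intro i j k hn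
    have hx := x_cyc n i j k hn
    apply TensorProduct.ext'
    intro a b
    simp only [LinearMap.add_apply, Module.End.mul_apply, LinearMap.zero_apply]
    have hn' := hn
    simp only [List.nodup_cons, List.mem_cons, List.not_mem_nil, not_or, or_false] at hn'
    obtain ⟨⟨h1, h2⟩, h3, -⟩ := hn'
    by_cases hij : f i = f j
    · by_cases hjk : f j = f k
      · have hki : f k = f i := (hij.trans hjk).symm
        have e1 : act (Equiv.swap i j) (x n j k) = - x n k i := by
          rw [act_x, Equiv.swap_apply_right,
            Equiv.swap_apply_of_ne_of_ne (Ne.symm h2) (Ne.symm h3), x_anti]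
        have e2 : act (Equiv.swap j k) (x n k i) = - x n i j := by
          rw [act_x, Equiv.swap_apply_right, Equiv.swap_apply_of_ne_of_ne h1 h2, x_anti]
        have e3 : act (Equiv.swap k i) (x n i j) = - x n j k := by
          rw [act_x, Equiv.swap_apply_right, Equiv.swap_apply_of_ne_of_ne h3 (Ne.symm h1), x_anti]
        have p1 : Equiv.swap j k * Equiv.swap k i = Equiv.swap i j * Equiv.swap j k := by
          ext t; simp only [Equiv.Perm.mul_apply, Equiv.swap_apply_def]; grind
        have p2 : Equiv.swap k i * Equiv.swap i j = Equiv.swap i j * Equiv.swap j k := by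
          ext t; simp only [Equiv.Perm.mul_apply, Equiv.swap_apply_def]; grind
        have hc : ((x n i j * x n j k + x n j k * x n k i + x n k i * x n i j) * a) ⊗ₜ[ℚ] b
            = 0 := by rw [hx]; simp
        have hd : (act (Equiv.swap i j * Equiv.swap j k) a) ⊗ₜ[ℚ]
            ((x n i j * x n j k + x n j k * x n k i + x n k i * x n i j) * b) = 0 := by
          rw [hx]; simp
        simp only [op_same f i j hij, op_same f j k hjk, op_same f k i hki, map_add, map_mul,
          e1, e2, e3, act_act, p1, p2]
        simp only [add_mul, TensorProduct.add_tmul, TensorProduct.tmul_add, mul_assoc, neg_mul,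
          neg_tmulE] at hc hd ⊢
        linear_combination (norm := module) hc + hd
      · exact op_cyc_mixed f i j k hn hij hjk a b
    · by_cases hjk : f j = f k
      · have := op_cyc_mixed f j k i (by simp; grind) hjk (by grind) a b
        rw [← this]; abel
      · by_cases hki : f k = f i
        · have := op_cyc_mixed f k i j (by simp; grind) hki hij a b
          rw [← this]; abel
        · have hc : ((x n i j * x n j k + x n j k * x n k i + x n k i * x n i j) * a) ⊗ₜ[ℚ] b
            = 0 := by rw [hx]; simp
          simp only [op_diff f i j hij, op_diff f j k hjk, op_diff f k i hki]
          simp only [add_mul, TensorProduct.add_tmul, mul_assoc] at hc ⊢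
          exact hc

theorem word_cons (n : ℕ) (p : Fin n × Fin n) (l : List (Fin n × Fin n)) :
    word n (p :: l) = x n p.1 p.2 * word n l := by simp [word]

theorem EG_le_span (n : ℕ) (G : SimpleGraph (Fin n)) (y : E n) (hy : y ∈ EG n G) :
    y ∈ Submodule.span ℚ {z | ∃ l : List (Fin n × Fin n),
      (∀ p ∈ l, G.Adj p.1 p.2) ∧ z = word n l} := by
  have hy' : y ∈ (EG n G).toSubmodule := hy
  rw [EG, Algebra.adjoin_eq_span] at hy'
  refine Submodule.span_mono ?_ hy'
  intro z hz
  induction hz using Submonoid.closure_induction_left with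
  | one => exact ⟨[], by simp, by simp [word]⟩
  | mul_left a ha b _ ih =>
    obtain ⟨i, j, hij, rfl⟩ := ha
    obtain ⟨l, hl, rfl⟩ := ih
    refine ⟨(i, j) :: l, ?_, by rw [word_cons]⟩
    intro p hp
    rcases List.mem_cons.1 hp with rfl | hp
    · exact hij
    · exact hl p hp

theorem word_mem_EG (n : ℕ) (G : SimpleGraph (Fin n)) (l : List (Fin n × Fin n))
    (hl : ∀ p ∈ l, G.Adj p.1 p.2) : word n l ∈ EG n G := by
  apply Subalgebra.list_prod_mem
  intro y hy
  obtain ⟨p, hp, rfl⟩ := List.mem_map.1 hy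
  exact Algebra.subset_adjoin ⟨p.1, p.2, hl p hp, rfl⟩

theorem mulMap_tmul (n : ℕ) (A B : Subalgebra ℚ (E n)) (a : A) (b : B) :
    mulMap n A B (a ⊗ₜ b) = (a : E n) * b := rfl

/-- `M f d` : span of the `a ⊗ w` with `w` a word in the within-block generators of
length `< d`. -/
def M {n : ℕ} (f : Fin n → Fin n) (d : ℕ) : Submodule ℚ (E n ⊗[ℚ] E n) :=
  Submodule.span ℚ {z | ∃ (a : E n) (l : List (Fin n × Fin n)),
    (∀ p ∈ l, f p.1 = f p.2) ∧ l.length < d ∧ z = a ⊗ₜ word n l}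

theorem M_zero {n : ℕ} (f : Fin n → Fin n) : M f 0 = ⊥ := by
  rw [M, Submodule.span_eq_bot]
  rintro z ⟨a, l, -, h, -⟩
  simp at h

theorem M_mono {n : ℕ} (f : Fin n → Fin n) {d e : ℕ} (h : d ≤ e) : M f d ≤ M f e :=
  Submodule.span_mono fun _ ⟨a, l, h1, h2, h3⟩ => ⟨a, l, h1, by omega, h3⟩

theorem map_left_M {n : ℕ} (f : Fin n → Fin n) (d : ℕ) (c : E n) (z : E n ⊗[ℚ] E n)
    (hz : z ∈ M f d) :
    TensorProduct.map (LinearMap.mulLeft ℚ c) LinearMap.id z ∈ M f d := by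
  induction hz using Submodule.span_induction with
  | mem z h =>
    obtain ⟨a, l, h1, h2, rfl⟩ := h
    exact Submodule.subset_span ⟨c * a, l, h1, h2, by simp⟩
  | zero => simp
  | add u v _ _ hu hv => rw [map_add]; exact add_mem hu hv
  | smul r u _ hu => rw [map_smul]; exact Submodule.smul_mem _ _ hu

theorem op_M {n : ℕ} (f : Fin n → Fin n) (d : ℕ) (i j : Fin n) (hij : f i = f j)
    (z : E n ⊗[ℚ] E n) (hz : z ∈ M f d) : op f i j z ∈ M f (d + 1) := by
  induction hz using Submodule.span_induction with
  | mem z h =>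
    obtain ⟨a, l, h1, h2, rfl⟩ := h
    rw [op_same f i j hij]
    refine add_mem (Submodule.subset_span ⟨_, l, h1, by omega, rfl⟩)
      (Submodule.subset_span ⟨_, (i, j) :: l, ?_, by simpa using h2, by rw [word_cons]⟩)
    intro p hp
    rcases List.mem_cons.1 hp with rfl | hp
    · exact hij
    · exact h1 p hp
  | zero => simp
  | add u v _ _ hu hv => rw [map_add]; exact add_mem hu hv
  | smul r u _ hu => rw [map_smul]; exact Submodule.smul_mem _ _ hu

theorem phi_word {n : ℕ} (f : Fin n → Fin n)
    (φ : E n →ₐ[ℚ] Module.End ℚ (E n ⊗[ℚ] E n)) (hφ : ∀ i j, φ (x n i j) = op f i j)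
    (l : List (Fin n × Fin n)) (hl : ∀ p ∈ l, f p.1 = f p.2) :
    ∃ m ∈ M f l.length, φ (word n l) (1 ⊗ₜ 1) = 1 ⊗ₜ word n l + m := by
  induction l with
  | nil => exact ⟨0, zero_mem _, by simp [word]⟩
  | cons p l ih =>
    obtain ⟨m, hm, e⟩ := ih (fun q hq => hl q (List.mem_cons_of_mem _ hq))
    have hp := hl p List.mem_cons_self
    have h1 := op_M f _ p.1 p.2 hp _ hm
    have h2 : op f p.1 p.2 (1 ⊗ₜ word n l) = (x n p.1 p.2) ⊗ₜ word n l +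
        1 ⊗ₜ word n (p :: l) := by
      rw [op_same f _ _ hp, word_cons]; simp
    have h3 : (x n p.1 p.2) ⊗ₜ[ℚ] word n l ∈ M f (l.length + 1) :=
      Submodule.subset_span ⟨_, l, fun q hq => hl q (List.mem_cons_of_mem _ hq), by simp, rfl⟩
    have h5 : φ (word n (p :: l)) (1 ⊗ₜ 1) = op f p.1 p.2 (φ (word n l) (1 ⊗ₜ 1)) := by
      rw [word_cons, map_mul, hφ]; rfl
    refine ⟨_, add_mem h3 h1, ?_⟩
    rw [h5, e, map_add, h2]
    module

theorem mapL_add {n : ℕ} (a a' : E n) (u : E n ⊗[ℚ] E n) :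
    TensorProduct.map (LinearMap.mulLeft ℚ (a + a')) LinearMap.id u =
      TensorProduct.map (LinearMap.mulLeft ℚ a) LinearMap.id u +
      TensorProduct.map (LinearMap.mulLeft ℚ a') LinearMap.id u := by
  induction u using TensorProduct.induction_on with
  | zero => simp
  | tmul c d => simp [add_mul, TensorProduct.add_tmul]
  | add u v hu hv => simp only [map_add, hu, hv]; abel

theorem mapL_smul {n : ℕ} (c : ℚ) (a : E n) (u : E n ⊗[ℚ] E n) :
    TensorProduct.map (LinearMap.mulLeft ℚ (c • a)) LinearMap.id u =
      c • TensorProduct.map (LinearMap.mulLeft ℚ a) LinearMap.id u := by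
  induction u using TensorProduct.induction_on with
  | zero => simp
  | tmul c d => simp [TensorProduct.smul_tmul']
  | add u v hu hv => simp only [map_add, hu, hv, smul_add]

/-- The unipotent map `a ⊗ b ↦ a · Δ(b)`. -/
noncomputable def Phi {n : ℕ} (φ : E n →ₐ[ℚ] Module.End ℚ (E n ⊗[ℚ] E n)) :
    E n ⊗[ℚ] E n →ₗ[ℚ] E n ⊗[ℚ] E n :=
  TensorProduct.lift (LinearMap.mk₂ ℚ
    (fun a b => TensorProduct.map (LinearMap.mulLeft ℚ a) LinearMap.id (φ b (1 ⊗ₜ 1)))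
    (by intro a a' b; exact mapL_add a a' _)
    (by intro c a b; exact mapL_smul c a _)
    (by intro a b b'; simp)
    (by intro c a b; simp))

theorem Phi_tmul {n : ℕ} (φ : E n →ₐ[ℚ] Module.End ℚ (E n ⊗[ℚ] E n)) (a b : E n) :
    Phi φ (a ⊗ₜ b) =
      TensorProduct.map (LinearMap.mulLeft ℚ a) LinearMap.id (φ b (1 ⊗ₜ 1)) := by
  simp [Phi]

theorem Phi_sub_M {n : ℕ} (f : Fin n → Fin n)
    (φ : E n →ₐ[ℚ] Module.End ℚ (E n ⊗[ℚ] E n)) (hφ : ∀ i j, φ (x n i j) = op f i j)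
    (d : ℕ) (z : E n ⊗[ℚ] E n) (hz : z ∈ M f (d + 1)) : ∃ m ∈ M f d, Phi φ z = z + m := by
  induction hz using Submodule.span_induction with
  | mem z h =>
    obtain ⟨a, l, h1, h2, rfl⟩ := h
    obtain ⟨m, hm, e⟩ := phi_word f φ hφ l h1
    refine ⟨_, M_mono f (by omega) (map_left_M f _ a _ hm), ?_⟩
    rw [Phi_tmul, e, map_add, TensorProduct.map_tmul]
    simp only [LinearMap.mulLeft_apply, mul_one, LinearMap.id_apply]
  | zero => exact ⟨0, zero_mem _, by simp⟩
  | add u v _ _ hu hv =>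
    obtain ⟨m, hm, e⟩ := hu
    obtain ⟨m', hm', e'⟩ := hv
    refine ⟨_, add_mem hm hm', ?_⟩
    rw [map_add, e, e']
    module
  | smul r u _ hu =>
    obtain ⟨m, hm, e⟩ := hu
    refine ⟨_, Submodule.smul_mem _ r hm, ?_⟩
    rw [map_smul, e, smul_add]

theorem Phi_inj {n : ℕ} (f : Fin n → Fin n)
    (φ : E n →ₐ[ℚ] Module.End ℚ (E n ⊗[ℚ] E n)) (hφ : ∀ i j, φ (x n i j) = op f i j)
    (d : ℕ) (z : E n ⊗[ℚ] E n) (hz : z ∈ M f d) (h : Phi φ z = 0) : z = 0 := by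
  induction d with
  | zero => simpa [M_zero] using hz
  | succ d ih =>
    apply ih
    obtain ⟨m, hm, e⟩ := Phi_sub_M f φ hφ d z hz
    rw [h] at e
    have : z = (-1 : ℚ) • m := by linear_combination (norm := module) -e
    rw [this]
    exact Submodule.smul_mem _ _ hm

/-- if `G₁` is a complete multipartite graph on `{1,…,n}` and `G₂ = G₁ᶜ` is
its complement, then the multiplication map `E_{G₁} ⊗_ℚ E_{G₂} → E_n`, `P ⊗ Q ↦ PQ`, is a
`ℚ`-linear bijection. -/
theorem stmt14_aux (n : ℕ) (hn : 1 ≤ n) (G₁ : SimpleGraph (Fin n))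
    (hmulti : ∃ f : Fin n → Fin n, ∀ i j : Fin n, G₁.Adj i j ↔ f i ≠ f j) :
    Function.Bijective (mulMap n (EG n G₁) (EG n G₁ᶜ)) := by
  obtain ⟨f, hf⟩ := hmulti
  constructor
  · obtain ⟨φ, hφ⟩ := exists_phi f
    letI : AddCommGroup (EG n G₁ ⊗[ℚ] EG n G₁ᶜ) := Module.addCommMonoidToAddCommGroup ℚ
    rw [← LinearMap.ker_eq_bot, LinearMap.ker_eq_bot']
    intro z hz
    set inc := TensorProduct.map (EG n G₁).val.toLinearMap (EG n G₁ᶜ).val.toLinearMap with hinc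
    have hinj : Function.Injective inc :=
      TensorProduct.map_injective_of_flat_flat _ _ Subtype.val_injective Subtype.val_injective
    have hword : ∀ (l : List (Fin n × Fin n)), (∀ p ∈ l, G₁.Adj p.1 p.2) → ∀ u : E n ⊗[ℚ] E n,
        φ (word n l) u = TensorProduct.map (LinearMap.mulLeft ℚ (word n l)) LinearMap.id u := by
      intro l hl
      induction l with
      | nil => intro u; simp [word]
      | cons p l ih =>
        intro u
        have ih := ih (fun q hq => hl q (List.mem_cons_of_mem _ hq))
        have hp : f p.1 ≠ f p.2 := (hf _ _).1 (hl p List.mem_cons_self)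
        rw [word_cons, map_mul, Module.End.mul_apply, ih, hφ]
        induction u using TensorProduct.induction_on with
        | zero => simp
        | tmul a b => simp [op_diff f _ _ hp, mul_assoc]
        | add u v hu hv => rw [map_add, map_add, hu, hv, map_add]
    have hA : ∀ a ∈ EG n G₁, ∀ u : E n ⊗[ℚ] E n,
        φ a u = TensorProduct.map (LinearMap.mulLeft ℚ a) LinearMap.id u := by
      intro a ha u
      have ha' := EG_le_span n G₁ a ha
      clear ha
      induction ha' using Submodule.span_induction with
      | mem a h =>
        obtain ⟨l, hl, rfl⟩ := h
        exact hword l hl u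
      | zero =>
        have := mapL_smul (0 : ℚ) (0 : E n) u
        rw [zero_smul, zero_smul] at this
        rw [this, map_zero]; rfl
      | add c d _ _ hc hd => rw [map_add, LinearMap.add_apply, hc, hd, mapL_add]
      | smul r c _ hc => rw [map_smul, LinearMap.smul_apply, hc, mapL_smul]
    have hkey : ∀ z, Phi φ (inc z) = φ (mulMap n (EG n G₁) (EG n G₁ᶜ) z) (1 ⊗ₜ 1) := by
      intro z
      induction z using TensorProduct.induction_on with
      | zero => simp
      | tmul a b =>
        rw [mulMap_tmul, map_mul, Module.End.mul_apply, hA _ a.2, hinc,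
          TensorProduct.map_tmul, Phi_tmul]
        rfl
      | add u v hu hv => rw [map_add, map_add, hu, hv, map_add, map_add]; rfl
    have hM : ∀ z, ∃ d, inc z ∈ M f d := by
      intro z
      induction z using TensorProduct.induction_on with
      | zero => exact ⟨0, by simp⟩
      | tmul a b =>
        have hb := EG_le_span n _ b b.2
        rw [hinc, TensorProduct.map_tmul]
        change ∃ d, (a : E n) ⊗ₜ[ℚ] (b : E n) ∈ M f d
        generalize (b : E n) = b at hb
        induction hb using Submodule.span_induction with
        | mem b h =>
          obtain ⟨l, hl, rfl⟩ := h
          refine ⟨l.length + 1, Submodule.subset_span ⟨_, l, ?_, by omega, rfl⟩⟩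
          intro p hp
          have := hl p hp
          rw [SimpleGraph.compl_adj, hf] at this
          exact not_not.1 this.2
        | zero => exact ⟨0, by simp⟩
        | add c d _ _ hc hd =>
          obtain ⟨d₁, h₁⟩ := hc
          obtain ⟨d₂, h₂⟩ := hd
          refine ⟨max d₁ d₂, ?_⟩
          rw [TensorProduct.tmul_add]
          exact add_mem (M_mono f (le_max_left _ _) h₁) (M_mono f (le_max_right _ _) h₂)
        | smul r c _ hc =>
          obtain ⟨d, h⟩ := hc
          refine ⟨d, ?_⟩
          rw [TensorProduct.tmul_smul]
          exact Submodule.smul_mem _ _ h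
      | add u v hu hv =>
        obtain ⟨d₁, h₁⟩ := hu
        obtain ⟨d₂, h₂⟩ := hv
        refine ⟨max d₁ d₂, ?_⟩
        rw [map_add]
        exact add_mem (M_mono f (le_max_left _ _) h₁) (M_mono f (le_max_right _ _) h₂)
    obtain ⟨d, hd⟩ := hM z
    apply hinj
    rw [map_zero]
    apply Phi_inj f φ hφ d _ hd
    rw [hkey, hz, map_zero]; rfl
  · set S := LinearMap.range (mulMap n (EG n G₁) (EG n G₁ᶜ)) with hS
    have hS1 : ∀ a ∈ EG n G₁, ∀ b ∈ EG n G₁ᶜ, a * b ∈ S :=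
      fun a ha b hb => ⟨⟨a, ha⟩ ⊗ₜ ⟨b, hb⟩, rfl⟩
    have hind : ∀ (T : E n →ₗ[ℚ] E n), (∀ a ∈ EG n G₁, ∀ b ∈ EG n G₁ᶜ, T (a * b) ∈ S) →
        ∀ s ∈ S, T s ∈ S := by
      rintro T hT _ ⟨z, rfl⟩
      induction z using TensorProduct.induction_on with
      | zero => simp
      | tmul a b => exact hT a a.2 b b.2
      | add u v hu hv => rw [map_add, map_add]; exact add_mem hu hv
    have hleft : ∀ c ∈ EG n G₁, ∀ s ∈ S, c * s ∈ S := by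
      intro c hc
      refine hind (LinearMap.mulLeft ℚ c) ?_
      intro a ha b hb
      rw [LinearMap.mulLeft_apply, ← mul_assoc]
      exact hS1 _ (mul_mem hc ha) _ hb
    have hright : ∀ c ∈ EG n G₁ᶜ, ∀ s ∈ S, s * c ∈ S := by
      intro c hc
      refine hind (LinearMap.mulRight ℚ c) ?_
      intro a ha b hb
      rw [LinearMap.mulRight_apply, mul_assoc]
      exact hS1 _ ha _ (mul_mem hb hc)
    have hAS : ∀ a ∈ EG n G₁, a ∈ S := fun a ha => by
      simpa using hS1 a ha 1 (one_mem _)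
    have hxA : ∀ i j, f i ≠ f j → x n i j ∈ EG n G₁ := fun i j h =>
      Algebra.subset_adjoin ⟨i, j, (hf i j).2 h, rfl⟩
    have hxB : ∀ i j, f i = f j → x n i j ∈ EG n G₁ᶜ := by
      intro i j h
      by_cases hij : i = j
      · subst hij; rw [x_diag]; exact zero_mem _
      · refine Algebra.subset_adjoin ⟨i, j, ?_, rfl⟩
        rw [SimpleGraph.compl_adj, hf]
        exact ⟨hij, not_not.2 h⟩
    have hw : ∀ (l : List (Fin n × Fin n)), (∀ p ∈ l, G₁.Adj p.1 p.2) →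
        ∀ i j, i ≠ j → f i = f j → x n i j * word n l ∈ S := by
      intro l hl
      induction l with
      | nil =>
        intro i j _ h
        simpa [word] using hS1 1 (one_mem _) _ (hxB i j h)
      | cons p l ih =>
        intro i j hne h
        have hl' : ∀ q ∈ l, G₁.Adj q.1 q.2 := fun q hq => hl q (List.mem_cons_of_mem _ hq)
        have ih := ih hl' i j hne h
        have hwl := word_mem_EG n G₁ l hl'
        obtain ⟨k, m⟩ := p
        have hkm : f k ≠ f m := (hf _ _).1 (hl (k, m) List.mem_cons_self)
        rw [word_cons]
        change x n i j * (x n k m * word n l) ∈ S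
        -- the three-term relation, for an edge meeting `{i, j}`
        have key : ∀ i' j' m', f i' = f j' → i' ≠ j' → f j' ≠ f m' →
            x n i' j' * word n l ∈ S → x n i' j' * (x n j' m' * word n l) ∈ S := by
          intro i' j' m' e1 e2 e3 e4
          have hc := x_cyc n i' j' m' (by simp; grind)
          have e : x n i' j' * (x n j' m' * word n l) =
              -(x n j' m' * (x n m' i' * word n l)) - x n m' i' * (x n i' j' * word n l) := by
            have := congrArg (· * word n l) hc
            simp only [add_mul, mul_assoc, zero_mul] at this
            linear_combination (norm := abel) this
          rw [e]
          have hmi : f m' ≠ f i' := by rw [e1]; exact Ne.symm e3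
          exact sub_mem (neg_mem (hAS _ (mul_mem (hxA _ _ e3) (mul_mem (hxA _ _ hmi) hwl))))
            (hleft _ (hxA _ _ hmi) _ e4)
        have ih' : x n j i * word n l ∈ S := by
          rw [x_anti n i j, neg_mul]; exact neg_mem ih
        by_cases hjk : j = k
        · subst hjk
          exact key i j m h hne hkm ih
        by_cases hjm : j = m
        · subst hjm
          rw [x_anti n j k, neg_mul, mul_neg]
          exact neg_mem (key i j k h hne (Ne.symm hkm) ih)
        by_cases hik : i = k
        · subst hik
          rw [x_anti n j i, neg_mul]
          exact neg_mem (key j i m h.symm (Ne.symm hne) hkm ih')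
        by_cases him : i = m
        · subst him
          rw [x_anti n j i, x_anti n i k, neg_mul, neg_mul, mul_neg, neg_neg]
          exact key j i k h.symm (Ne.symm hne) (Ne.symm hkm) ih'
        rw [← mul_assoc, x_comm n i j k m (by simp; grind), mul_assoc]
        exact hleft _ (hxA _ _ hkm) _ ih
    have hgen : ∀ i j, ∀ s ∈ S, x n i j * s ∈ S := by
      intro i j
      by_cases h : f i = f j
      · by_cases hne : i = j
        · subst hne; intro s _; rw [x_diag, zero_mul]; exact zero_mem _
        refine hind (LinearMap.mulLeft ℚ (x n i j)) ?_
        intro a ha b hb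
        rw [LinearMap.mulLeft_apply, ← mul_assoc]
        apply hright b hb
        have ha' := EG_le_span n G₁ a ha
        clear ha
        induction ha' using Submodule.span_induction with
        | mem a h' =>
          obtain ⟨l, hl, rfl⟩ := h'
          exact hw l hl i j hne h
        | zero => rw [mul_zero]; exact zero_mem _
        | add c d _ _ hc hd => rw [mul_add]; exact add_mem hc hd
        | smul r c _ hc => rw [mul_smul_comm]; exact Submodule.smul_mem _ _ hc
      · exact hleft _ (hxA i j h)
    have hall : ∀ y : FreeAlgebra ℚ (Fin n × Fin n), ∀ s ∈ S,
        RingQuot.mkAlgHom ℚ (Rel n) y * s ∈ S := by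
      intro y
      induction y using FreeAlgebra.induction with
      | grade0 r =>
        intro s hs
        rw [AlgHom.commutes, ← Algebra.smul_def]
        exact Submodule.smul_mem _ _ hs
      | grade1 p => exact hgen p.1 p.2
      | mul a b ha hb =>
        intro s hs
        rw [map_mul, mul_assoc]
        exact ha _ (hb _ hs)
      | add a b ha hb =>
        intro s hs
        rw [map_add, add_mul]
        exact add_mem (ha _ hs) (hb _ hs)
    intro y
    obtain ⟨y, rfl⟩ := RingQuot.mkAlgHom_surjective ℚ (Rel n) y
    have := hall y 1 (hAS 1 (one_mem _))
    rw [mul_one] at this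
    exact this

end

/-- if `G₁` is a complete multipartite graph on `{1,…,n}` and `G₂ = G₁ᶜ` is
its complement, then the multiplication map `E_{G₁} ⊗_ℚ E_{G₂} → E_n`, `P ⊗ Q ↦ PQ`, is a
`ℚ`-linear bijection. -/
theorem stmt14 (n : ℕ) (hn : 1 ≤ n) (G₁ : SimpleGraph (Fin n))
    (hmulti : ∃ f : Fin n → Fin n, ∀ i j : Fin n, G₁.Adj i j ↔ f i ≠ f j) :
    Function.Bijective (mulMap n (EG n G₁) (EG n G₁ᶜ)) :=
  stmt14_aux n hn G₁ hmulti

end FK
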